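/- arXiv:2308.10073 — 6 statements merged into one kernel-verified Lean document; each statement's English description precedes it below -/
import Mathlib

section
/- Let M be a finite commutative monoid with n = |M| elements and let S be a finite subset of M. Then an element g ∈ M belongs to the submonoid generated by S if and only if there exist natural numbers e_s with 0 ≤ e_s ≤ n for each s ∈ S such that g = ∏_{s∈S} s^{e_s}. -/
/-- Every power of an element of a finite monoid equals one whose exponent is less than the
cardinality of the monoid. -/
theorem exists_lt_card_pow_eq {M : Type*} [Monoid M] [Fintype M] (a : M) (k : ℕ) :
    ∃ m < Fintype.card M, a ^ m = a ^ k := by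
  induction k using Nat.strong_induction_on with
  | _ k ih =>
    by_cases hk : k < Fintype.card M
    · exact ⟨k, hk, rfl⟩
    obtain ⟨i, j, hij, h⟩ : ∃ i j : Fin (Fintype.card M + 1), i < j ∧ a ^ (i : ℕ) = a ^ (j : ℕ) := by
      obtain ⟨x, y, hne, h⟩ := Fintype.exists_ne_map_eq_of_card_lt
        (fun x : Fin (Fintype.card M + 1) => a ^ (x : ℕ)) (by simp)
      rcases hne.lt_or_gt with hlt | hlt
      · exact ⟨x, y, hlt, h⟩
      · exact ⟨y, x, hlt, h.symm⟩
    have hij' : (i : ℕ) < j := hij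
    have hjk : (j : ℕ) ≤ k := by omega
    obtain ⟨m, hm, hmk⟩ := ih (k - j + i) (by omega)
    refine ⟨m, hm, ?_⟩
    rw [hmk, pow_add, h, ← pow_add, Nat.sub_add_cancel hjk]

/-- In a finite commutative monoid `M` with `n` elements, `g` lies in the submonoid
generated by the finite set `S` iff `g = ∏_{s ∈ S} s ^ (e s)` for some exponents
`0 ≤ e s ≤ n`. -/
theorem mem_closure_iff_prod_pow {M : Type*} [CommMonoid M] [Fintype M]
    (n : ℕ) (hn : n = Fintype.card M) (S : Finset M) (g : M) :
    g ∈ Submonoid.closure (S : Set M) ↔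
      ∃ e : M → ℕ, (∀ s ∈ S, e s ≤ n) ∧ g = ∏ s ∈ S, s ^ e s := by
  constructor
  · intro hg
    obtain ⟨f, -, rfl⟩ := Submonoid.mem_closure_finset.mp hg
    choose e he heq using fun s : M => exists_lt_card_pow_eq s (f s)
    exact ⟨e, fun s _ => hn ▸ (he s).le, Finset.prod_congr rfl fun s _ => (heq s).symm⟩
  · rintro ⟨e, -, rfl⟩
    exact prod_mem fun s hs => pow_mem (Submonoid.subset_closure hs) _
end

section
/- Let G be a finite abelian group of order n with prime factorization n = p₁^{a₁} · p₂^{a₂} ⋯ p_μ^{a_μ}, let b_i = n / p_i^{a_i} for 1 ≤ i ≤ μ, let S ⊆ G, and let S_i = {x^{b_i} : x ∈ S}. Then for every g ∈ G, g belongs to the subgroup ⟨S⟩ generated by S if and only if g^{b_i} belongs to the subgroup ⟨S_i⟩ for every i with 1 ≤ i ≤ μ. -/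
/-- If `g ^ k i ∈ H` for every `i` and no prime divides both `Nat.card G` and all the `k i`,
then `g ∈ H`. -/
theorem Subgroup.mem_of_forall_pow_mem {G ι : Type*} [CommGroup G] (H : Subgroup G) {g : G}
    (k : ι → ℕ) (hk : ∀ q : ℕ, q.Prime → q ∣ Nat.card G → ∃ i, ¬ q ∣ k i)
    (h : ∀ i, g ^ k i ∈ H) : g ∈ H := by
  have hdvd : ∀ i, orderOf (g : G ⧸ H) ∣ k i := fun i =>
    orderOf_dvd_of_pow_eq_one <| by
      rw [← QuotientGroup.mk_pow]
      exact (QuotientGroup.eq_one_iff _).mpr (h i)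
  have hone : orderOf (g : G ⧸ H) = 1 := by
    by_contra hne
    obtain ⟨q, hq, hqd⟩ := Nat.exists_prime_and_dvd hne
    obtain ⟨i, hi⟩ := hk q hq <|
      hqd.trans <| (_root_.orderOf_dvd_natCard _).trans H.card_quotient_dvd_card
    exact hi (hqd.trans (hdvd i))
  exact (QuotientGroup.eq_one_iff g).mp (orderOf_eq_one_iff.mp hone)

/-- A prime of a factorization into distinct prime powers does not divide its cofactor. -/
theorem Nat.Prime.not_dvd_prod_pow_div {ι : Type*} [Fintype ι] {p : ι → ℕ} (a : ι → ℕ)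
    (hp : ∀ i, (p i).Prime) (hdist : Function.Injective p) (i : ι) :
    ¬ p i ∣ (∏ j, p j ^ a j) / p i ^ a i := by
  classical
  rw [← Finset.mul_prod_erase Finset.univ (fun j => p j ^ a j) (Finset.mem_univ i),
    Nat.mul_div_cancel_left _ (pow_pos (hp i).pos _), (hp i).prime.dvd_finsetProd_iff]
  rintro ⟨j, hj, hd⟩
  exact Finset.ne_of_mem_erase hj
    (hdist ((Nat.prime_dvd_prime_iff_eq (hp i) (hp j)).mp ((hp i).dvd_of_dvd_pow hd)).symm)

/-- For a finite abelian group `G` of order `n = p₁^{a₁} ⋯ p_μ^{a_μ}` and `b i = n / p i ^ a i`,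
an element `g` lies in `⟨S⟩` iff `g ^ (b i)` lies in `⟨S_i⟩` for each `i`, where
`S_i = {x ^ (b i) : x ∈ S}`. -/
theorem mem_closure_iff_pow_mem_sylow_parts {G : Type*} [CommGroup G] [Fintype G]
    (n : ℕ) (hn : n = Fintype.card G)
    (μ : ℕ) (p a : Fin μ → ℕ)
    (hp : ∀ i, (p i).Prime) (hdist : Function.Injective p) (hpos : ∀ i, 0 < a i)
    (hfact : n = ∏ i, p i ^ a i)
    (b : Fin μ → ℕ) (hb : ∀ i, b i = n / p i ^ a i)
    (S : Set G) (g : G) :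
    g ∈ Subgroup.closure S ↔
      ∀ i : Fin μ, g ^ b i ∈ Subgroup.closure ((fun x : G => x ^ b i) '' S) := by
  constructor
  · intro hg i
    have hmap := Subgroup.mem_map_of_mem (powMonoidHom (b i)) hg
    rwa [MonoidHom.map_closure] at hmap
  · intro h
    refine Subgroup.mem_of_forall_pow_mem _ b (fun q hq hqn => ?_) fun i => ?_
    · rw [Nat.card_eq_fintype_card, ← hn, hfact, hq.prime.dvd_finsetProd_iff] at hqn
      obtain ⟨i, -, hi⟩ := hqn
      obtain rfl := (Nat.prime_dvd_prime_iff_eq hq (hp i)).mp (hq.dvd_of_dvd_pow hi)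
      refine ⟨i, ?_⟩
      rw [hb, hfact]
      exact Nat.Prime.not_dvd_prod_pow_div a hp hdist i
    · refine (Subgroup.closure_le _).mpr ?_ (h i)
      rintro _ ⟨x, hx, rfl⟩
      exact pow_mem (Subgroup.subset_closure hx) _
end

section
/- Let G be a finite group with n = |G|, let δ be a real number with 0 ≤ δ < 1/13, and let m : G × G → G be a binary operation such that the number of pairs (a,b) ∈ G × G with m(a,b) ≠ a·b is at most δ·n. Then for all x, y ∈ G, the number of pairs (z,w) ∈ G × G with m(z,w) = 1 and m(m(x,z), m(w,y)) = x·y is at least (1−6δ)·n, and this number strictly exceeds the number of pairs (z,w) with m(z,w) = 1 and m(m(x,z), m(w,y)) ≠ x·y; hence x·y is the strict majority value of m(m(x,z), m(w,y)) over pairs (z,w) with m(z,w) = 1. -/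
open Finset

/-- The number of preimages of a finset under an injective map is at most its cardinality. -/
lemma card_filter_mem_le_of_injective {α β : Type*} [Fintype α] [DecidableEq β]
    (E : Finset β) {f : α → β} (hf : Function.Injective f) :
    ((univ : Finset α).filter (fun a => f a ∈ E)).card ≤ E.card :=
  card_le_card_of_injOn f (fun a ha => by simpa using ha) hf.injOn

/-- Self-correction of a corrupted group multiplication table: for all `x, y`, among the
pairs `(z,w)` with `m(z,w) = 1`, at least `(1-6δ)·n` of them satisfy
`m(m(x,z), m(w,y)) = x·y`, and these strictly outnumber the pairs `(z,w)` with
`m(z,w) = 1` giving any other value; hence `x·y` is the strict majority value. -/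
theorem corrupted_table_majority_decoding {G : Type*} [Group G] [Fintype G] [DecidableEq G]
    (n : ℕ) (hn : n = Fintype.card G)
    (δ : ℝ) (hδ0 : 0 ≤ δ) (hδ : δ < 1 / 13)
    (m : G → G → G)
    (herr : (((univ : Finset (G × G)).filter
        (fun ab : G × G => m ab.1 ab.2 ≠ ab.1 * ab.2)).card : ℝ) ≤ δ * n) :
    ∀ x y : G,
      ((1 - 6 * δ) * n ≤ (((univ : Finset (G × G)).filter
          (fun zw : G × G => m zw.1 zw.2 = 1 ∧
            m (m x zw.1) (m zw.2 y) = x * y)).card : ℝ)) ∧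
      (((univ : Finset (G × G)).filter
          (fun zw : G × G => m zw.1 zw.2 = 1 ∧
            m (m x zw.1) (m zw.2 y) ≠ x * y)).card <
        ((univ : Finset (G × G)).filter
          (fun zw : G × G => m zw.1 zw.2 = 1 ∧
            m (m x zw.1) (m zw.2 y) = x * y)).card) := by
  intro x y
  set E := (univ : Finset (G × G)).filter (fun ab : G × G => m ab.1 ab.2 ≠ ab.1 * ab.2) with hE
  have mul_of_notMem : ∀ a b : G, (a, b) ∉ E → m a b = a * b := by
    intro a b h
    simpa [hE] using h
  set good := (univ : Finset (G × G)).filter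
    (fun zw : G × G => m zw.1 zw.2 = 1 ∧ m (m x zw.1) (m zw.2 y) = x * y) with hgood
  set bad := (univ : Finset (G × G)).filter
    (fun zw : G × G => m zw.1 zw.2 = 1 ∧ m (m x zw.1) (m zw.2 y) ≠ x * y) with hbad
  let B₁ := (univ : Finset G).filter (fun z => (z, z⁻¹) ∈ E)
  let B₂ := (univ : Finset G).filter (fun z => (x, z) ∈ E)
  let B₃ := (univ : Finset G).filter (fun z => (z⁻¹, y) ∈ E)
  let B₄ := (univ : Finset G).filter (fun z => (x * z, z⁻¹ * y) ∈ E)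
  let B := (B₁ ∪ B₂) ∪ (B₃ ∪ B₄)
  have hB : B.card ≤ 4 * E.card := by
    have h₁ : B₁.card ≤ E.card :=
      card_filter_mem_le_of_injective E fun a b h => (Prod.ext_iff.mp h).1
    have h₂ : B₂.card ≤ E.card :=
      card_filter_mem_le_of_injective E fun a b h => (Prod.ext_iff.mp h).2
    have h₃ : B₃.card ≤ E.card :=
      card_filter_mem_le_of_injective E fun a b h => inv_injective (Prod.ext_iff.mp h).1
    have h₄ : B₄.card ≤ E.card :=
      card_filter_mem_le_of_injective E fun a b h => mul_left_cancel (Prod.ext_iff.mp h).1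
    have h₅ : B.card ≤ (B₁ ∪ B₂).card + (B₃ ∪ B₄).card := card_union_le _ _
    have h₆ := card_union_le B₁ B₂
    have h₇ := card_union_le B₃ B₄
    omega
  have decode : ∀ z : G, z ∉ B →
      m z z⁻¹ = 1 ∧ m (m x z) (m z⁻¹ y) = x * y := by
    intro z hz
    simp only [B, B₁, B₂, B₃, B₄, mem_union, mem_filter, mem_univ, true_and, not_or] at hz
    obtain ⟨⟨h₁, h₂⟩, h₃, h₄⟩ := hz
    rw [mul_of_notMem _ _ h₁, mul_of_notMem _ _ h₂, mul_of_notMem _ _ h₃, mul_of_notMem _ _ h₄]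
    constructor <;> group
  have hgood_card : n ≤ good.card + 4 * E.card := by
    have h₁ : Bᶜ.card ≤ good.card := by
      refine card_le_card_of_injOn (fun z => (z, z⁻¹)) (fun z hz => ?_)
        fun a _ b _ h => (Prod.ext_iff.mp h).1
      simpa [hgood] using decode z (by simpa using hz)
    have h₂ := card_add_card_compl B
    omega
  have hbad_card : bad.card ≤ 5 * E.card := by
    have hsub : bad ⊆ E ∪ B.image (fun z => (z, z⁻¹)) := by
      rintro ⟨z, w⟩ hzw
      simp only [hbad, mem_filter, mem_univ, true_and] at hzw
      by_cases hmem : (z, w) ∈ E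
      · exact mem_union_left _ hmem
      · have hw : w = z⁻¹ := by
          rw [mul_of_notMem _ _ hmem] at hzw
          exact eq_inv_of_mul_eq_one_right hzw.1
        subst hw
        refine mem_union_right _ (mem_image_of_mem _ ?_)
        by_contra hz
        exact hzw.2 (decode z hz).2
    have h₁ := card_le_card hsub
    have h₂ := card_union_le E (B.image (fun z => (z, z⁻¹)))
    have h₃ : (B.image (fun z => (z, z⁻¹))).card ≤ B.card := card_image_le
    omega
  have hn_pos : (0 : ℝ) < n := by
    rw [hn]
    exact_mod_cast Fintype.card_pos
  have hgood_real : (n : ℝ) ≤ good.card + 4 * E.card := by exact_mod_cast hgood_card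
  have hbad_real : (bad.card : ℝ) ≤ 5 * E.card := by exact_mod_cast hbad_card
  have hδn_nonneg : 0 ≤ δ * n := by positivity
  have hδn_lt : δ * n < 1 / 13 * n := mul_lt_mul_of_pos_right hδ hn_pos
  refine ⟨by linarith, ?_⟩
  have h_lt : (bad.card : ℝ) < good.card := by linarith
  exact_mod_cast h_lt
end

section
/- Let X be a finite set with n = |X| ≥ 1 elements carrying two group structures with multiplications μ₁ and μ₂, let δ be a real number with 0 ≤ δ < 1/13, and let m : X × X → X be a binary operation such that the number of pairs (a,b) with m(a,b) ≠ μ₁(a,b) is at most δ·n and the number of pairs (a,b) with m(a,b) ≠ μ₂(a,b) is at most δ·n. Then μ₁ = μ₂; in particular, at most one group multiplication table on X lies within edit distance δ·n of any given table m. -/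
open Finset

/-- In a finite group, if more than half of the elements lie in `s`, every element is a product of
two elements of `s`. -/
theorem exists_mul_eq_of_card_lt_two_mul_card {G : Type*} [Group G] [Fintype G] [DecidableEq G]
    {s : Finset G} (hs : Fintype.card G < 2 * s.card) (x : G) :
    ∃ a ∈ s, ∃ b ∈ s, a * b = x := by
  have hcard : (s.image fun a => a⁻¹ * x).card = s.card :=
    card_image_of_injective _ fun a b h => by simpa using h
  have hlt : (univ : Finset G).card < s.card + (s.image fun a => a⁻¹ * x).card := by
    rw [hcard, card_univ]; omega
  obtain ⟨b, hb⟩ := inter_nonempty_of_card_lt_card_add_card (subset_univ s) (subset_univ _) hlt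
  obtain ⟨hbs, hb'⟩ := mem_inter.mp hb
  obtain ⟨a, ha, rfl⟩ := mem_image.mp hb'
  exact ⟨a, ha, _, hbs, by group⟩

/-- An associative operation on a finite group which differs from the group multiplication in fewer
than half as many entries as there are elements is the group multiplication. -/
theorem mul_eq_of_two_mul_card_ne_lt {G : Type*} [Group G] [Fintype G] [DecidableEq G]
    (op : G → G → G) (assoc : ∀ a b c, op (op a b) c = op a (op b c))
    (h : 2 * ((univ : Finset (G × G)).filter
      fun ab : G × G => ab.1 * ab.2 ≠ op ab.1 ab.2).card < Fintype.card G) (a b : G) :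
    a * b = op a b := by
  set D := (univ : Finset (G × G)).filter fun ab : G × G => ab.1 * ab.2 ≠ op ab.1 ab.2
  set s := (D.image Prod.fst)ᶜ with hs
  have agree : ∀ x ∈ s, ∀ y, x * y = op x y := by
    intro x hx y
    by_contra hne
    exact mem_compl.mp hx (mem_image.mpr ⟨(x, y), by simpa [D] using hne, rfl⟩)
  have hcard : Fintype.card G < 2 * s.card := by
    have h1 : (D.image Prod.fst).card ≤ D.card := card_image_le
    rw [hs, card_compl]
    omega
  obtain ⟨x, hx, y, hy, rfl⟩ := exists_mul_eq_of_card_lt_two_mul_card hcard a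
  rw [mul_assoc, agree y hy, agree x hx, agree x hx, assoc]

/-- At most one group multiplication table on a finite set `X` lies within edit distance
`δ·n` (for `δ < 1/13`) of a given table `m`: if two group structures `G₁`, `G₂` on `X`
both have multiplication tables within `δ·n` of `m`, then their multiplications coincide. -/
theorem unique_group_within_edit_distance {X : Type*} [Fintype X] [DecidableEq X]
    (hn : 1 ≤ Fintype.card X)
    (G₁ G₂ : Group X)
    (δ : ℝ) (hδ0 : 0 ≤ δ) (hδ : δ < 1 / 13)
    (m : X → X → X)
    (h₁ : (((univ : Finset (X × X)).filter
        (fun ab : X × X => m ab.1 ab.2 ≠ G₁.mul ab.1 ab.2)).card : ℝ)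
        ≤ δ * Fintype.card X)
    (h₂ : (((univ : Finset (X × X)).filter
        (fun ab : X × X => m ab.1 ab.2 ≠ G₂.mul ab.1 ab.2)).card : ℝ)
        ≤ δ * Fintype.card X) :
    G₁.mul = G₂.mul := by
  let D (G : Group X) := (univ : Finset (X × X)).filter
    fun ab : X × X => m ab.1 ab.2 ≠ G.mul ab.1 ab.2
  have hsub : ((univ : Finset (X × X)).filter
      fun ab : X × X => G₁.mul ab.1 ab.2 ≠ G₂.mul ab.1 ab.2) ⊆ D G₁ ∪ D G₂ := by
    intro ab hab
    by_contra hnot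
    simp only [D, mem_union, mem_filter, mem_univ, true_and, not_or, not_not] at hab hnot
    exact hab (hnot.1.symm.trans hnot.2)
  have hle := (card_le_card hsub).trans (card_union_le _ _)
  have hlt : 2 * ((D G₁).card + (D G₂).card) < Fintype.card X := by
    have hpos : (1 : ℝ) ≤ Fintype.card X := by exact_mod_cast hn
    have : 2 * (((D G₁).card : ℝ) + (D G₂).card) < Fintype.card X := by
      simp only [D]
      nlinarith
    exact_mod_cast this
  funext a b
  exact @mul_eq_of_two_mul_card_ne_lt X G₁ _ _ G₂.mul G₂.mul_assoc
    (lt_of_le_of_lt (Nat.mul_le_mul_left 2 hle) hlt) a b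
end

section
/- Let p be a prime and let G₁ and G₂ be finite abelian p-groups. Then G₁ and G₂ are isomorphic if and only if for every natural number j, the subgroup of p^j-th powers {x^{p^j} : x ∈ G₁} of G₁ and the subgroup of p^j-th powers {x^{p^j} : x ∈ G₂} of G₂ have the same cardinality. -/
/-- The number of `n`-th powers in a group is an isomorphism invariant. -/
theorem MulEquiv.card_range_pow_eq {G H : Type*} [Monoid G] [Monoid H] (e : G ≃* H) (n : ℕ) :
    Nat.card (Set.range (fun x : G => x ^ n)) = Nat.card (Set.range (fun x : H => x ^ n)) := by
  have h : e '' Set.range (fun x : G => x ^ n) = Set.range (fun x : H => x ^ n) := by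
    ext y
    simp [e.surjective.exists]
  rw [← h, Nat.card_image_of_injective e.injective]

/-- The number of `p ^ j`-th powers in a cyclic group of order `p ^ e`. -/
theorem ZMod.card_range_prime_pow_pow {p : ℕ} (hp : p.Prime) (e j : ℕ) :
    Nat.card (Set.range (fun x : Multiplicative (ZMod (p ^ e)) => x ^ p ^ j)) = p ^ (e - j) := by
  have : NeZero (p ^ e) := ⟨pow_ne_zero e hp.ne_zero⟩
  have h := IsCyclic.card_powMonoidHom_range (G := Multiplicative (ZMod (p ^ e))) (p ^ j)
  have hc : Nat.card (Multiplicative (ZMod (p ^ e))) = p ^ e := by simp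
  rw [hc] at h
  refine Eq.trans h ?_
  rcases le_total e j with hj | hj
  · rw [Nat.gcd_eq_left (pow_dvd_pow p hj), Nat.sub_eq_zero_of_le hj, pow_zero,
      Nat.div_self (pow_pos hp.pos e)]
  · rw [Nat.gcd_eq_right (pow_dvd_pow p hj), Nat.pow_div hj hp.pos]

/-- The number of `n`-th powers in a finite product of monoids. -/
theorem Pi.card_range_pow {ι : Type*} [Fintype ι] (M : ι → Type*) [∀ i, Monoid (M i)] (n : ℕ) :
    Nat.card (Set.range (fun x : (i : ι) → M i => x ^ n)) =
      ∏ i, Nat.card (Set.range (fun x : M i => x ^ n)) := by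
  have h : Set.range (fun x : (i : ι) → M i => x ^ n) =
      Set.univ.pi fun i => Set.range (fun x : M i => x ^ n) :=
    Set.range_piMap fun _ x => x ^ n
  rw [h, Nat.card_congr (Equiv.Set.univPi _), Nat.card_pi]

/-- A finite abelian `p`-group is a product of nontrivial cyclic groups of `p`-power order. -/
theorem IsPGroup.exists_mulEquiv_pi_zmod {p : ℕ} (hp : p.Prime) {G : Type*} [CommGroup G]
    [Finite G] (hG : IsPGroup p G) :
    ∃ (ι : Type) (_ : Fintype ι) (e : ι → ℕ), (∀ i, 0 < e i) ∧
      Nonempty (G ≃* ((i : ι) → Multiplicative (ZMod (p ^ e i)))) := by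
  have : Fact p.Prime := ⟨hp⟩
  obtain ⟨ι, _, n, hn, ⟨f⟩⟩ := CommGroup.equiv_prod_multiplicative_zmod_of_finite G
  obtain ⟨k, hk⟩ := IsPGroup.iff_card.mp hG
  have hcard : ∏ i, n i = p ^ k := by
    rw [← hk, Nat.card_congr f.toEquiv, Nat.card_pi]
    exact Finset.prod_congr rfl fun i _ => (Nat.card_zmod (n i)).symm
  have hpow (i : ι) : ∃ e, n i = p ^ e := by
    obtain ⟨e, -, he⟩ :=
      (Nat.dvd_prime_pow hp).mp (hcard ▸ Finset.dvd_prod_of_mem n (Finset.mem_univ i))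
    exact ⟨e, he⟩
  choose e he using hpow
  obtain rfl : n = fun i => p ^ e i := funext he
  refine ⟨ι, ‹_›, e, fun i => Nat.pos_of_ne_zero fun h => ?_, ⟨f⟩⟩
  simpa [h] using hn i

/-- Second differences of `j ↦ ∑ i, (e i - j)` count the indices with a given value. -/
theorem Fintype.sum_tsub_add_sum_tsub {ι : Type*} [Fintype ι] (e : ι → ℕ) (k : ℕ) :
    ∑ i, (e i - k) + ∑ i, (e i - (k + 2)) =
      2 * ∑ i, (e i - (k + 1)) + Fintype.card {i // e i = k + 1} := by
  rw [Fintype.card_subtype, Finset.card_filter, Finset.mul_sum, ← Finset.sum_add_distrib,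
    ← Finset.sum_add_distrib]
  refine Finset.sum_congr rfl fun i _ => ?_
  split_ifs <;> omega

/-- Families of positive naturals are determined up to reindexing by the truncated sums
`∑ i, (e i - j)`. -/
theorem Fintype.exists_equiv_of_sum_tsub_eq {ι κ : Type*} [Fintype ι] [Fintype κ] {e : ι → ℕ}
    {f : κ → ℕ} (he : ∀ i, 0 < e i) (hf : ∀ i, 0 < f i)
    (h : ∀ j, ∑ i, (e i - j) = ∑ i, (f i - j)) : ∃ σ : ι ≃ κ, ∀ i, f (σ i) = e i := by
  have hfib (k : ℕ) : Nonempty ({i // e i = k} ≃ {i // f i = k}) := by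
    cases k with
    | zero =>
      have : IsEmpty {i // e i = 0} := ⟨fun i => (he i).ne' i.2⟩
      have : IsEmpty {i // f i = 0} := ⟨fun i => (hf i).ne' i.2⟩
      exact ⟨Equiv.equivOfIsEmpty _ _⟩
    | succ k =>
      have h₁ := sum_tsub_add_sum_tsub e k
      have h₂ := sum_tsub_add_sum_tsub f k
      rw [h, h, h] at h₁
      exact ⟨Fintype.equivOfCardEq (by omega)⟩
  exact ⟨Equiv.ofFiberEquiv fun k => (hfib k).some, Equiv.ofFiberEquiv_map _⟩


/-- Two finite abelian `p`-groups are isomorphic iff for every `j` their subgroups of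
`p^j`-th powers have the same cardinality. -/
theorem abelian_pGroup_iso_iff_power_subgroup_cards (p : ℕ) (hp : p.Prime)
    {G₁ G₂ : Type*} [CommGroup G₁] [CommGroup G₂] [Finite G₁] [Finite G₂]
    (h₁ : IsPGroup p G₁) (h₂ : IsPGroup p G₂) :
    Nonempty (G₁ ≃* G₂) ↔
      ∀ j : ℕ,
        Nat.card (Set.range (fun x : G₁ => x ^ p ^ j)) =
          Nat.card (Set.range (fun x : G₂ => x ^ p ^ j)) := by
  refine ⟨fun ⟨e⟩ j => e.card_range_pow_eq (p ^ j), fun h => ?_⟩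
  obtain ⟨ι, _, e, he, ⟨φ⟩⟩ := h₁.exists_mulEquiv_pi_zmod hp
  obtain ⟨κ, _, f, hf, ⟨ψ⟩⟩ := h₂.exists_mulEquiv_pi_zmod hp
  have hsum (j : ℕ) : ∑ i, (e i - j) = ∑ i, (f i - j) := by
    have hj := h j
    simp only [φ.card_range_pow_eq, ψ.card_range_pow_eq, Pi.card_range_pow,
      ZMod.card_range_prime_pow_pow hp, Finset.prod_pow_eq_pow_sum] at hj
    exact Nat.pow_right_injective hp.two_le hj
  obtain ⟨σ, hσ⟩ := Fintype.exists_equiv_of_sum_tsub_eq he hf hsum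
  obtain rfl : (fun i => f (σ i)) = e := funext hσ
  let ρ : ((i : κ) → Multiplicative (ZMod (p ^ f i))) ≃*
      ((i : ι) → Multiplicative (ZMod (p ^ f (σ i)))) :=
    { (Equiv.piCongrLeft (fun i => Multiplicative (ZMod (p ^ f i))) σ).symm with
      map_mul' := fun _ _ => rfl }
  exact ⟨(φ.trans ρ.symm).trans ψ.symm⟩
end

section
/- Two finite abelian groups G₁ and G₂ are isomorphic if and only if for every positive integer k, the number of elements of order k in G₁ equals the number of elements of order k in G₂. -/
namespace MonoidHom

variable {H G : Type*} [Group H] [Group G]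

/-- Homomorphisms with kernel `N` are the injective homomorphisms out of `H ⧸ N`. -/
noncomputable def kerEqEquivInjective (N : Subgroup H) [N.Normal] :
    {f : H →* G // f.ker = N} ≃ {f : H ⧸ N →* G // Function.Injective f} where
  toFun f := ⟨QuotientGroup.lift N f.1 f.2.ge, (QuotientGroup.injective_lift_iff _ _ _).2 f.2.symm⟩
  invFun f := ⟨f.1.comp (QuotientGroup.mk' N), by
    rw [← MonoidHom.comap_ker, (MonoidHom.ker_eq_bot_iff _).2 f.2, MonoidHom.comap_bot,
      QuotientGroup.ker_mk']⟩
  left_inv f := by ext; rfl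
  right_inv f := by ext; rfl

theorem card_eq_sum_card_ker_eq [Finite H] [Finite G] [Fintype (Subgroup H)] :
    Nat.card (H →* G) = ∑ N : Subgroup H, Nat.card {f : H →* G // f.ker = N} := by
  have : Finite (H →* G) := DFunLike.finite _
  rw [← Nat.card_sigma, Nat.card_congr (Equiv.sigmaFiberEquiv (MonoidHom.ker (G := H) (M := G)))]

end MonoidHom

/-- If two finite groups receive equally many homomorphisms from every finite abelian group,
then they receive equally many injective ones. -/
theorem card_injective_eq_of_card_monoidHom_eq.{u, v, w} {G₁ : Type v} {G₂ : Type w}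
    [Group G₁] [Group G₂] [Finite G₁] [Finite G₂]
    (hom : ∀ (H : Type u) [CommGroup H] [Finite H], Nat.card (H →* G₁) = Nat.card (H →* G₂))
    (H : Type u) [CommGroup H] [Finite H] :
    Nat.card {f : H →* G₁ // Function.Injective f} =
      Nat.card {f : H →* G₂ // Function.Injective f} := by
  classical
  induction hn : Nat.card H using Nat.strong_induction_on generalizing H with
  | _ n ih =>
    have := Fintype.ofFinite (Subgroup H)
    have key := hom H
    rw [MonoidHom.card_eq_sum_card_ker_eq, MonoidHom.card_eq_sum_card_ker_eq,
      ← Finset.add_sum_erase _ _ (Finset.mem_univ ⊥),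
      ← Finset.add_sum_erase _ _ (Finset.mem_univ ⊥)] at key
    have hsum : ∀ N ∈ Finset.univ.erase (⊥ : Subgroup H),
        Nat.card {f : H →* G₁ // f.ker = N} = Nat.card {f : H →* G₂ // f.ker = N} := by
      intro N hN
      rw [Nat.card_congr (MonoidHom.kerEqEquivInjective N),
        Nat.card_congr (MonoidHom.kerEqEquivInjective N)]
      refine ih _ ?_ (H ⧸ N) rfl
      rw [← hn, N.card_eq_card_quotient_mul_card_subgroup]
      exact lt_mul_of_one_lt_right Nat.card_pos
        (N.one_lt_card_iff_ne_bot.2 (Finset.ne_of_mem_erase hN))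
    rw [Finset.sum_congr rfl hsum] at key
    simpa only [MonoidHom.ker_eq_bot_iff] using Nat.add_right_cancel key

/-- Homomorphisms out of `ZMod n` correspond to elements whose `n`-th power is `1`. -/
noncomputable def zmodMonoidHomEquiv (n : ℕ) (G : Type*) [Group G] :
    (Multiplicative (ZMod n) →* G) ≃ {g : G // g ^ n = 1} :=
  AddMonoidHom.toMultiplicativeLeft.symm.trans <| (ZMod.lift n).symm.trans <|
    ((zmultiplesHom (Additive G)).symm.trans Additive.toMul).subtypeEquiv fun f ↦ by
      have hf : f n = n • f 1 := by rw [← map_nsmul, nsmul_one]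
      simp [hf, ← toMul_nsmul]

theorem card_monoidHom_eq_prod {ι : Type*} [Fintype ι] {n : ι → ℕ} {H G : Type*} [CommGroup H]
    [CommGroup G] (e : H ≃* ((i : ι) → Multiplicative (ZMod (n i)))) :
    Nat.card (H →* G) = ∏ i, Nat.card {g : G // g ^ n i = 1} := by
  classical
  rw [Nat.card_congr (e.monoidHomCongrLeftEquiv.trans
    (Pi.monoidHomMulEquiv (fun i ↦ Multiplicative (ZMod (n i))) G).toEquiv), Nat.card_pi]
  exact Finset.prod_congr rfl fun i _ ↦ Nat.card_congr (zmodMonoidHomEquiv (n i) G)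

theorem card_pow_eq_one_eq_sum_card_orderOf {G : Type*} [Group G] [Finite G] {n : ℕ} (hn : n ≠ 0) :
    Nat.card {g : G // g ^ n = 1} = ∑ d ∈ n.divisors, Nat.card {g : G | orderOf g = d} := by
  classical
  have := Fintype.ofFinite G
  simpa [Nat.card_eq_fintype_card, Fintype.card_subtype] using
    (sum_card_orderOf_eq_card_pow_eq_one (G := G) hn).symm

/-- Two finite abelian groups are isomorphic iff for every positive integer `k` they have
the same number of elements of order `k`. -/
theorem abelian_iso_iff_order_counts {G₁ G₂ : Type*} [CommGroup G₁] [CommGroup G₂]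
    [Finite G₁] [Finite G₂] :
    Nonempty (G₁ ≃* G₂) ↔
      ∀ k : ℕ, 0 < k →
        Nat.card {g : G₁ | orderOf g = k} = Nat.card {g : G₂ | orderOf g = k} := by
  refine ⟨fun ⟨e⟩ k _ ↦ Nat.card_congr (e.toEquiv.subtypeEquiv fun g ↦ ?_), fun h ↦ ?_⟩
  · simp
  have pow_eq (n : ℕ) (hn : n ≠ 0) :
      Nat.card {g : G₁ // g ^ n = 1} = Nat.card {g : G₂ // g ^ n = 1} := by
    rw [card_pow_eq_one_eq_sum_card_orderOf hn, card_pow_eq_one_eq_sum_card_orderOf hn]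
    exact Finset.sum_congr rfl fun d hd ↦ h d (Nat.pos_of_mem_divisors hd)
  have inj := card_injective_eq_of_card_monoidHom_eq (G₁ := G₁) (G₂ := G₂) (fun H _ _ ↦ by
    obtain ⟨ι, _, n, hn, ⟨e⟩⟩ := CommGroup.equiv_prod_multiplicative_zmod_of_finite H
    rw [card_monoidHom_eq_prod e, card_monoidHom_eq_prod e]
    exact Finset.prod_congr rfl fun i _ ↦ pow_eq _ (hn i).ne_bot) G₁
  have : Finite (G₁ →* G₁) := DFunLike.finite _
  have : Nonempty {f : G₁ →* G₁ // Function.Injective f} := ⟨.id G₁, Function.injective_id⟩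
  obtain ⟨⟨f, hf⟩⟩ := (Nat.card_pos_iff.1 (inj ▸ Nat.card_pos)).1
  have hcard : Nat.card G₁ = Nat.card G₂ := by
    have key := pow_eq (Nat.card G₁ * Nat.card G₂) (mul_ne_zero Nat.card_pos.ne' Nat.card_pos.ne')
    rwa [Nat.card_congr (Equiv.subtypeUnivEquiv fun g ↦ by rw [pow_mul, pow_card_eq_one', one_pow]),
      Nat.card_congr (Equiv.subtypeUnivEquiv fun g ↦ by
        rw [pow_mul', pow_card_eq_one', one_pow])] at key
  exact ⟨.ofBijective f ((Nat.bijective_iff_injective_and_card f).2 ⟨hf, hcard⟩)⟩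
end
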